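/- Let A be a nonempty finite set, ε ∈ (0,1], and let p and p̂ be probability weights on A with p(a) ≥ ε and p̂(a) ≥ ε for all a. Then ∑_a p(a)·(log(p(a)/p̂(a)))² ≤ (2/ε)·KL(p ‖ p̂), where KL(p ‖ p̂) = ∑_a p(a)·log(p(a)/p̂(a)). -/

import Mathlib

open BigOperators

lemma aux_g (t : ℝ) (ht : 0 ≤ t) : t ^ 2 / 2 ≤ 1 - Real.exp t + t * Real.exp t := by
  have hd : ∀ x : ℝ, HasDerivAt (fun t : ℝ => 1 - Real.exp t + t * Real.exp t - t ^ 2 / 2)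
      (x * Real.exp x - x) x := by
    intro x
    have h := ((((Real.hasDerivAt_exp x).const_sub 1).add
      ((hasDerivAt_id x).mul (Real.hasDerivAt_exp x))).sub (((hasDerivAt_id x).pow 2).div_const 2))
    refine h.congr_deriv ?_
    simp
  have hm : MonotoneOn (fun t : ℝ => 1 - Real.exp t + t * Real.exp t - t ^ 2 / 2)
      (Set.Ici 0) := by
    apply monotoneOn_of_deriv_nonneg (convex_Ici 0)
    · exact fun x _ => (hd x).continuousAt.continuousWithinAt
    · exact fun x _ => (hd x).differentiableAt.differentiableWithinAt
    · intro x hx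
      rw [interior_Ici, Set.mem_Ioi] at hx
      rw [(hd x).deriv]
      nlinarith [Real.add_one_le_exp x]
  have := hm (Set.mem_Ici.2 le_rfl) (Set.mem_Ici.2 ht) ht
  simp at this
  linarith

lemma aux_h (ε t : ℝ) (hε1 : ε ≤ 1) (h : ε ≤ Real.exp (-t)) :
    ε * t ^ 2 / 2 ≤ t - 1 + Real.exp (-t) := by
  rcases le_total 0 t with ht | ht
  · have h1 := aux_g t ht
    have h2 : Real.exp (-t) * Real.exp t = 1 := by rw [← Real.exp_add]; simp
    have h3 := mul_le_mul_of_nonneg_left h1 (Real.exp_pos (-t)).le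
    have h4 : Real.exp (-t) * (1 - Real.exp t + t * Real.exp t) = t - 1 + Real.exp (-t) := by
      linear_combination (t - 1) * h2
    nlinarith [mul_le_mul_of_nonneg_right h (sq_nonneg t)]
  · have := Real.quadratic_le_exp_of_nonneg (x := -t) (by linarith)
    nlinarith [mul_le_mul_of_nonneg_right hε1 (sq_nonneg t)]

/-- Lemma (Expected KL to L₂ log-policy error): for clipped probability weights
`p, p̂ ≥ ε`, `∑_a p(a) (log(p(a)/p̂(a)))² ≤ (2/ε) · KL(p ‖ p̂)`. -/
theorem stmt_15 {A : Type*} [Fintype A] [Nonempty A]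
    (ε : ℝ) (hε0 : 0 < ε) (hε1 : ε ≤ 1)
    (p phat : A → ℝ) (hp1 : ∑ a, p a = 1) (hphat1 : ∑ a, phat a = 1)
    (hp : ∀ a, ε ≤ p a) (hphat : ∀ a, ε ≤ phat a) :
    ∑ a, p a * Real.log (p a / phat a) ^ 2 ≤
      2 / ε * ∑ a, p a * Real.log (p a / phat a) := by
  have hpp : ∀ a, 0 < p a := fun a => hε0.trans_le (hp a)
  have hqq : ∀ a, 0 < phat a := fun a => hε0.trans_le (hphat a)
  have key : ∑ a, p a * Real.log (p a / phat a) =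
      ∑ a, (p a * Real.log (p a / phat a) - p a + phat a) := by
    rw [Finset.sum_add_distrib, Finset.sum_sub_distrib, hp1, hphat1]; ring
  rw [key, Finset.mul_sum]
  apply Finset.sum_le_sum
  intro a _
  have hle : p a ≤ 1 := by
    rw [← hp1]
    exact Finset.single_le_sum (fun i _ => (hpp i).le) (Finset.mem_univ a)
  have he : Real.exp (-Real.log (p a / phat a)) = phat a / p a := by
    rw [Real.exp_neg, Real.exp_log (div_pos (hpp a) (hqq a)), inv_div]
  have hx := aux_h ε (Real.log (p a / phat a)) hε1 (by
    rw [he, le_div_iff₀ (hpp a)]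
    nlinarith [hphat a])
  rw [he] at hx
  have h3 := mul_le_mul_of_nonneg_left hx (hpp a).le
  have h4 : p a * (phat a / p a) = phat a := mul_div_cancel₀ _ (hpp a).ne'
  rw [div_mul_eq_mul_div, le_div_iff₀ hε0]
  rw [mul_add, h4] at h3
  linarith
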